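/- arXiv:2311.02276 — 7 statements merged into one kernel-verified Lean document; each statement's English description precedes it below -/
import Mathlib

section
/- Let α > 1. There exists a constant c > 0, depending only on α, such that for every ξ₀ ∈ ℝ, every n₀ ∈ ℤ, every C > 0 and every K ≥ 1, the set 𝒢_K = { (ξ, n) ∈ ℝ × ℤ : C ≤ | (ξ − ξ₀)² − (1/2)(|n|^{2α} + |n − n₀|^{2α}) | ≤ C + K } satisfies 𝔪(𝒢_K) ≤ c K. -/
open MeasureTheory

/-- The symmetric dispersion `(|n|^{2α} + |n - n₀|^{2α}) / 2`. -/
noncomputable def symmDispersion (α : ℝ) (n₀ n : ℤ) : ℝ :=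
  (1 / 2) * (|(n : ℝ)| ^ (2 * α) + |((n - n₀ : ℤ) : ℝ)| ^ (2 * α))

/-- The weight `min 1 |k|^{-α}`, equal to `1` at `k = 0`. -/
noncomputable def decayWeight (α : ℝ) (k : ℤ) : ℝ := (max 1 (|(k : ℝ)| ^ α))⁻¹

lemma decayWeight_pos (α : ℝ) (k : ℤ) : 0 < decayWeight α k := by
  unfold decayWeight; positivity

lemma summable_decayWeight {α : ℝ} (hα : 1 < α) : Summable (decayWeight α) := by
  refine (Real.summable_abs_int_rpow hα).congr_cofinite ?_
  have hfin : ({0}ᶜ : Set ℤ) ∈ Filter.cofinite := by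
    simp [Filter.mem_cofinite, -Int.cofinite_eq]
  filter_upwards [hfin] with k hk
  have hk1 : (1 : ℝ) ≤ |(k : ℝ)| := by
    exact_mod_cast Int.one_le_abs (by simpa using hk)
  rw [decayWeight, max_eq_right (Real.one_le_rpow hk1 (by linarith)),
    Real.rpow_neg (abs_nonneg _)]

lemma convexOn_abs_rpow {p : ℝ} (hp : 1 ≤ p) :
    ConvexOn ℝ Set.univ (fun x : ℝ => |x| ^ p) := by
  refine ⟨convex_univ, fun x _ y _ a b ha hb hab => ?_⟩
  have h := (convexOn_rpow hp).2 (Set.mem_Ici.2 (abs_nonneg x)) (Set.mem_Ici.2 (abs_nonneg y))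
    ha hb hab
  refine le_trans ?_ h
  refine Real.rpow_le_rpow (abs_nonneg _) ?_ (by linarith)
  simp only [smul_eq_mul]
  calc |a * x + b * y| ≤ |a * x| + |b * y| := abs_add_le _ _
    _ = a * |x| + b * |y| := by rw [abs_mul, abs_mul, abs_of_nonneg ha, abs_of_nonneg hb]

/-- A convex function has increments over `[m, m + j]` at least those over `[0, j]`. -/
lemma ConvexOn.add_le_add_zero {f : ℝ → ℝ} (hf : ConvexOn ℝ Set.univ f) {m j : ℝ}
    (hm : 0 ≤ m) (hj : 0 ≤ j) : f m + f j ≤ f (m + j) + f 0 := by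
  rcases (add_nonneg hm hj).eq_or_lt with h | h
  · obtain rfl : m = 0 := by linarith
    simp [add_comm]
  have h1 := hf.2 (Set.mem_univ (m + j)) (Set.mem_univ 0)
    (show 0 ≤ m / (m + j) by positivity) (show 0 ≤ j / (m + j) by positivity) (by field_simp)
  have h2 := hf.2 (Set.mem_univ (m + j)) (Set.mem_univ 0)
    (show 0 ≤ j / (m + j) by positivity) (show 0 ≤ m / (m + j) by positivity) (by field_simp; ring)
  simp only [smul_eq_mul, mul_zero, add_zero, div_mul_cancel₀ _ h.ne'] at h1 h2
  have h3 : m / (m + j) + j / (m + j) = 1 := by field_simp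
  calc f m + f j ≤ (m / (m + j) + j / (m + j)) * (f (m + j) + f 0) := by linarith
    _ = _ := by rw [h3, one_mul]

lemma abs_rpow_two_mul (x α : ℝ) : |x| ^ (2 * α) = (x ^ 2) ^ α := by
  rw [Real.rpow_mul (abs_nonneg x), Real.rpow_two, sq_abs]

/-- The scalar Clarkson inequality for exponents `2α ≥ 2`. -/
lemma clarkson_abs_rpow {α : ℝ} (hα : 1 ≤ α) (a b : ℝ) :
    |a| ^ (2 * α) + |b| ^ (2 * α) ≤ (1 / 2) * (|a + b| ^ (2 * α) + |a - b| ^ (2 * α)) := by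
  simp only [abs_rpow_two_mul]
  have h := (convexOn_rpow hα).2 (Set.mem_Ici.2 (sq_nonneg (a + b)))
    (Set.mem_Ici.2 (sq_nonneg (a - b))) (show (0 : ℝ) ≤ 1 / 2 by norm_num)
    (show (0 : ℝ) ≤ 1 / 2 by norm_num) (by norm_num)
  simp only [smul_eq_mul] at h
  rw [show 1 / 2 * (a + b) ^ 2 + 1 / 2 * (a - b) ^ 2 = a ^ 2 + b ^ 2 by ring] at h
  linarith [Real.add_rpow_le_rpow_add (sq_nonneg a) (sq_nonneg b) hα]

lemma symmDispersion_growth {α : ℝ} (hα : 1 ≤ α) {n₀ n₁ n : ℤ} (h₁ : n₀ ≤ 2 * n₁)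
    (hn : n₁ ≤ n) :
    symmDispersion α n₀ n₁ + |((n - n₁ : ℤ) : ℝ)| ^ (2 * α) ≤ symmDispersion α n₀ n := by
  have hg := convexOn_abs_rpow (p := 2 * α) (by linarith)
  set h : ℝ := n₀ / 2 with hh
  have hm : (0 : ℝ) ≤ n₁ - h := by
    have : (n₀ : ℝ) ≤ 2 * n₁ := by exact_mod_cast h₁
    linarith
  have hj : (0 : ℝ) ≤ n - n₁ := by
    have : (n₁ : ℝ) ≤ n := by exact_mod_cast hn
    linarith
  have hp := (hg.translate_right h).add_le_add_zero hm hj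
  have hq := (hg.translate_right (-h)).add_le_add_zero hm hj
  have hc := clarkson_abs_rpow hα h (n - n₁)
  have e : |h - ((n : ℝ) - n₁)| = |-h + ((n : ℝ) - n₁)| := by
    rw [← abs_neg]; congr 1; ring
  simp only [Function.comp_apply] at hp hq
  rw [e] at hc
  unfold symmDispersion
  push_cast
  have e1 : h + (n₁ - h) = (n₁ : ℝ) := by ring
  have e2 : -h + (n₁ - h) = (n₁ : ℝ) - n₀ := by rw [hh]; ring
  have e3 : h + (n₁ - h + (n - n₁)) = (n : ℝ) := by ring
  have e4 : -h + (n₁ - h + (n - n₁)) = (n : ℝ) - n₀ := by rw [hh]; ring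
  rw [e1, e3] at hp
  rw [e2, e4] at hq
  simp only [add_zero, abs_neg] at hp hq
  linarith

lemma symmDispersion_reflect (α : ℝ) (n₀ n : ℤ) :
    symmDispersion α n₀ (n₀ - n) = symmDispersion α n₀ n := by
  unfold symmDispersion
  rw [show n₀ - n - n₀ = -n by ring, show n₀ - n = -(n - n₀) by ring]
  push_cast
  rw [abs_neg, abs_neg, add_comm]

/-- The points whose squared distance to `ξ₀` lies in `[b - K, b]`. -/
def sqShell (ξ₀ K b : ℝ) : Set ℝ := {x | b - K ≤ (x - ξ₀) ^ 2 ∧ (x - ξ₀) ^ 2 ≤ b}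

lemma volume_sqShell_le_sqrt (ξ₀ K b : ℝ) (hK : 0 ≤ K) :
    volume (sqShell ξ₀ K b) ≤ ENNReal.ofReal (2 * (√b - √(b - K))) := by
  have hs : √(b - K) ≤ √b := Real.sqrt_le_sqrt (by linarith)
  have hsub : sqShell ξ₀ K b ⊆
      Set.Icc (ξ₀ + √(b - K)) (ξ₀ + √b) ∪ Set.Icc (ξ₀ - √b) (ξ₀ - √(b - K)) := by
    rintro x ⟨h1, h2⟩
    have h1' := Real.sqrt_le_sqrt h1
    have h2' := Real.sqrt_le_sqrt h2
    rw [Real.sqrt_sq_eq_abs] at h1' h2'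
    rcases le_total 0 (x - ξ₀) with hx | hx
    · rw [abs_of_nonneg hx] at h1' h2'
      exact Or.inl ⟨by linarith, by linarith⟩
    · rw [abs_of_nonpos hx] at h1' h2'
      exact Or.inr ⟨by linarith, by linarith⟩
  refine (measure_mono hsub).trans ((measure_union_le _ _).trans ?_)
  rw [Real.volume_Icc, Real.volume_Icc, ← ENNReal.ofReal_add (by linarith) (by linarith)]
  exact ENNReal.ofReal_le_ofReal (by linarith)

lemma volume_sqShell_le_decayWeight {α ξ₀ K b : ℝ} (hK : 1 ≤ K) {k : ℤ}
    (hb : |(k : ℝ)| ^ (2 * α) ≤ b) :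
    volume (sqShell ξ₀ K b) ≤ ENNReal.ofReal (2 * K * decayWeight α k) := by
  refine (volume_sqShell_le_sqrt ξ₀ K b (by linarith)).trans (ENNReal.ofReal_le_ofReal ?_)
  have hb0 : 0 ≤ b := le_trans (by positivity) hb
  have hsb := Real.sq_sqrt hb0
  have hs := Real.sqrt_nonneg (b - K)
  have hle : √(b - K) ≤ √b := Real.sqrt_le_sqrt (by linarith)
  have hsq : b - K ≤ √(b - K) ^ 2 := by
    rcases le_total 0 (b - K) with h | h
    · exact (Real.sq_sqrt h).ge
    · exact h.trans (sq_nonneg _)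
  have hone : √b - √(b - K) ≤ K := by nlinarith
  have hpow : |(k : ℝ)| ^ α ≤ √b := by
    refine Real.le_sqrt_of_sq_le ?_
    rw [← Real.rpow_natCast, ← Real.rpow_mul (abs_nonneg _)]
    simpa [mul_comm] using hb
  have hmul : (√b - √(b - K)) * max 1 (|(k : ℝ)| ^ α) ≤ K := by
    rcases max_cases 1 (|(k : ℝ)| ^ α) with ⟨h, -⟩ | ⟨h, -⟩ <;> rw [h]
    · linarith
    · nlinarith
  have hdiv : √b - √(b - K) ≤ K * decayWeight α k := by
    rw [decayWeight, ← div_eq_mul_inv, le_div_iff₀ (by positivity)]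
    exact hmul
  linarith

lemma sqShell_eq_empty {ξ₀ K b : ℝ} (hb : b < 0) : sqShell ξ₀ K b = ∅ :=
  Set.eq_empty_of_forall_notMem fun x hx => by
    have := hx.2
    nlinarith [sq_nonneg (x - ξ₀)]

/-- The shells to the right of the centre `n₀ / 2` are dominated by a translate of the weight
starting at the first nonempty one. -/
lemma tsum_right_volume_sqShell_le {α : ℝ} (hα : 1 < α) (ξ₀ e : ℝ) {K : ℝ} (hK : 1 ≤ K)
    (n₀ : ℤ) :
    ∑' n, Set.indicator {n : ℤ | n₀ ≤ 2 * n}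
        (fun n => volume (sqShell ξ₀ K (symmDispersion α n₀ n + e))) n
      ≤ ENNReal.ofReal (2 * K * ∑' k, decayWeight α k) := by
  by_cases hS : ∃ n : ℤ, n₀ ≤ 2 * n ∧ 0 ≤ symmDispersion α n₀ n + e
  · obtain ⟨n₁, ⟨h₁, he⟩, hmin⟩ := Int.exists_least_of_bdd
      (P := fun n : ℤ => n₀ ≤ 2 * n ∧ 0 ≤ symmDispersion α n₀ n + e)
      ⟨-|n₀|, fun z hz => by have := hz.1; rcases abs_cases n₀ with h | h <;> omega⟩ hS
    have hle : ∀ n, Set.indicator {n : ℤ | n₀ ≤ 2 * n}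
        (fun n => volume (sqShell ξ₀ K (symmDispersion α n₀ n + e))) n
          ≤ ENNReal.ofReal (2 * K * decayWeight α (n - n₁)) := by
      intro n
      refine Set.indicator_apply_le' (fun hn => ?_) fun _ => bot_le
      rcases lt_or_ge (symmDispersion α n₀ n + e) 0 with hneg | hnn
      · simp [sqShell_eq_empty hneg]
      · refine volume_sqShell_le_decayWeight hK ?_
        linarith [symmDispersion_growth hα.le h₁ (hmin n ⟨hn, hnn⟩)]
    refine (ENNReal.tsum_le_tsum hle).trans (le_of_eq ?_)
    refine ((Equiv.subRight n₁).tsum_eq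
      (fun k => ENNReal.ofReal (2 * K * decayWeight α k))).trans ?_
    rw [← ENNReal.ofReal_tsum_of_nonneg
        (fun k => mul_nonneg (by linarith) (decayWeight_pos α k).le)
        ((summable_decayWeight hα).mul_left _), tsum_mul_left]
  · refine le_of_eq_of_le (ENNReal.tsum_eq_zero.2 fun n => ?_) (zero_le (a := ENNReal.ofReal _))
    refine Set.indicator_apply_eq_zero.2 fun hn => ?_
    have hneg : symmDispersion α n₀ n + e < 0 := not_le.1 fun h => hS ⟨n, hn, h⟩
    simp [sqShell_eq_empty hneg]

lemma tsum_volume_sqShell_le {α : ℝ} (hα : 1 < α) (ξ₀ e : ℝ) {K : ℝ} (hK : 1 ≤ K) (n₀ : ℤ) :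
    ∑' n, volume (sqShell ξ₀ K (symmDispersion α n₀ n + e))
      ≤ ENNReal.ofReal (4 * K * ∑' k, decayWeight α k) := by
  set T : ℤ → ENNReal := fun n => volume (sqShell ξ₀ K (symmDispersion α n₀ n + e)) with hT
  set R : ℤ → ENNReal := Set.indicator {n : ℤ | n₀ ≤ 2 * n} T with hR
  have hle : ∀ n, T n ≤ R n + R (n₀ - n) := by
    intro n
    have hrefl : T (n₀ - n) = T n := by simp only [hT, symmDispersion_reflect]
    rcases le_total n₀ (2 * n) with h | h
    · rw [hR, Set.indicator_of_mem (show n ∈ {n : ℤ | n₀ ≤ 2 * n} from h)]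
      exact le_self_add
    · rw [hR, Set.indicator_of_mem (a := n₀ - n) (show n₀ ≤ 2 * (n₀ - n) by omega), hrefl]
      exact le_add_self
  have hright := tsum_right_volume_sqShell_le hα ξ₀ e hK n₀
  have hW : 0 ≤ 2 * K * ∑' k, decayWeight α k :=
    mul_nonneg (by linarith) (tsum_nonneg fun k => (decayWeight_pos α k).le)
  calc ∑' n, T n ≤ ∑' n, (R n + R (n₀ - n)) := ENNReal.tsum_le_tsum hle
    _ = ∑' n, R n + ∑' n, R n := by
      rw [ENNReal.tsum_add]
      congr 1
      exact (Equiv.subLeft n₀).tsum_eq R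
    _ ≤ ENNReal.ofReal (2 * K * ∑' k, decayWeight α k)
        + ENNReal.ofReal (2 * K * ∑' k, decayWeight α k) := add_le_add hright hright
    _ = ENNReal.ofReal (4 * K * ∑' k, decayWeight α k) := by
      rw [← ENNReal.ofReal_add hW hW]; congr 1; ring

/-- hyperbolic level-set measure bound, `α > 1`. -/
theorem hyperbolic_level_set_measure_bound (α : ℝ) (hα : 1 < α) :
    ∃ c : ℝ, 0 < c ∧ ∀ (ξ₀ : ℝ) (n₀ : ℤ) (C K : ℝ), 0 < C → 1 ≤ K →
      ((volume : Measure ℝ).prod (Measure.count : Measure ℤ))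
        {p : ℝ × ℤ |
          C ≤ |(p.1 - ξ₀) ^ 2 -
                (1 / 2) * (|(p.2 : ℝ)| ^ (2 * α) + |((p.2 - n₀ : ℤ) : ℝ)| ^ (2 * α))| ∧
          |(p.1 - ξ₀) ^ 2 -
                (1 / 2) * (|(p.2 : ℝ)| ^ (2 * α) + |((p.2 - n₀ : ℤ) : ℝ)| ^ (2 * α))| ≤ C + K}
        ≤ ENNReal.ofReal (c * K) := by
  have hWpos : 0 < ∑' k, decayWeight α k :=
    (summable_decayWeight hα).tsum_pos (fun k => (decayWeight_pos α k).le) 0 (decayWeight_pos α 0)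
  refine ⟨8 * ∑' k, decayWeight α k, by positivity, fun ξ₀ n₀ C K hC hK => ?_⟩
  have hmeas : Measurable fun p : ℝ × ℤ => |(p.1 - ξ₀) ^ 2 -
      (1 / 2) * (|(p.2 : ℝ)| ^ (2 * α) + |((p.2 - n₀ : ℤ) : ℝ)| ^ (2 * α))| := by
    have h : Measurable fun p : ℝ × ℤ => symmDispersion α n₀ p.2 :=
      (measurable_of_countable (symmDispersion α n₀)).comp measurable_snd
    exact (((measurable_fst.sub_const ξ₀).pow_const 2).sub h).abs
  refine (Measure.prod_apply_symm ((measurableSet_le measurable_const hmeas).inter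
    (measurableSet_le hmeas measurable_const))).trans_le ?_
  rw [lintegral_count]
  have hle : ∀ n : ℤ, volume ((fun x : ℝ => (x, n)) ⁻¹' {p : ℝ × ℤ |
          C ≤ |(p.1 - ξ₀) ^ 2 -
                (1 / 2) * (|(p.2 : ℝ)| ^ (2 * α) + |((p.2 - n₀ : ℤ) : ℝ)| ^ (2 * α))| ∧
          |(p.1 - ξ₀) ^ 2 -
                (1 / 2) * (|(p.2 : ℝ)| ^ (2 * α) + |((p.2 - n₀ : ℤ) : ℝ)| ^ (2 * α))| ≤ C + K})
      ≤ volume (sqShell ξ₀ K (symmDispersion α n₀ n + (C + K)))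
        + volume (sqShell ξ₀ K (symmDispersion α n₀ n + -C)) := by
    intro n
    refine (measure_mono ?_).trans (measure_union_le _ _)
    rintro x ⟨h1, h2⟩
    change C ≤ |(x - ξ₀) ^ 2 - symmDispersion α n₀ n| at h1
    change |(x - ξ₀) ^ 2 - symmDispersion α n₀ n| ≤ C + K at h2
    rcases abs_cases ((x - ξ₀) ^ 2 - symmDispersion α n₀ n) with ⟨h, -⟩ | ⟨h, -⟩ <;>
      rw [h] at h1 h2
    · exact Or.inl ⟨by linarith, by linarith⟩
    · exact Or.inr ⟨by linarith, by linarith⟩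
  refine (ENNReal.tsum_le_tsum hle).trans ?_
  rw [ENNReal.tsum_add]
  refine (add_le_add (tsum_volume_sqShell_le hα ξ₀ (C + K) hK n₀)
    (tsum_volume_sqShell_le hα ξ₀ (-C) hK n₀)).trans (le_of_eq ?_)
  rw [← ENNReal.ofReal_add (by positivity) (by positivity)]
  congr 1
  ring
end

section
/- Let α > 1. There exists a constant c > 0, depending only on α, such that for every n₀ ∈ ℤ, every C > 0 and every K ≥ 1, the set 𝒢_K⁺ = { (ξ, n) ∈ ℝ × ℤ : C ≤ ξ² − (1/2)(|n|^{2α} + |n − n₀|^{2α}) ≤ C + K } satisfies 𝔪(𝒢_K⁺) ≤ c K. -/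
open MeasureTheory

lemma Real.volume_sq_mem_Icc_le {b c : ℝ} (hbc : b ≤ c) :
    volume {x : ℝ | b ≤ x ^ 2 ∧ x ^ 2 ≤ c} ≤ ENNReal.ofReal (2 * (√c - √b)) := by
  have hsub : {x : ℝ | b ≤ x ^ 2 ∧ x ^ 2 ≤ c} ⊆ Set.Icc (√b) (√c) ∪ Set.Icc (-√c) (-√b) := by
    rintro x ⟨h₁, h₂⟩
    have h₁' : √b ≤ |x| := by simpa [Real.sqrt_sq_eq_abs] using Real.sqrt_le_sqrt h₁
    have h₂' : |x| ≤ √c := by simpa [Real.sqrt_sq_eq_abs] using Real.sqrt_le_sqrt h₂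
    rcases le_total 0 x with hx | hx
    · rw [abs_of_nonneg hx] at h₁' h₂'
      exact Or.inl ⟨h₁', h₂'⟩
    · rw [abs_of_nonpos hx] at h₁' h₂'
      exact Or.inr ⟨by linarith, by linarith⟩
  have h : 0 ≤ √c - √b := sub_nonneg.2 (Real.sqrt_le_sqrt hbc)
  calc volume {x : ℝ | b ≤ x ^ 2 ∧ x ^ 2 ≤ c}
      ≤ volume (Set.Icc (√b) (√c)) + volume (Set.Icc (-√c) (-√b)) :=
        (measure_mono hsub).trans (measure_union_le _ _)
    _ = ENNReal.ofReal (2 * (√c - √b)) := by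
        rw [Real.volume_Icc, Real.volume_Icc, neg_sub_neg, ← ENNReal.ofReal_add h h, two_mul]

lemma Real.sqrt_add_sub_sqrt_le_of_sq_half_le {b K t : ℝ} (ht : 0 < t) (hK : 0 ≤ K)
    (htb : t ^ 2 / 2 ≤ b) : √(b + K) - √b ≤ K * t⁻¹ := by
  have hb : 0 ≤ b := by nlinarith
  have h₁ : √b ^ 2 = b := Real.sq_sqrt hb
  have h₂ : √(b + K) ^ 2 = b + K := Real.sq_sqrt (by linarith)
  have hle : √b ≤ √(b + K) := Real.sqrt_le_sqrt (by linarith)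
  have h₀ := Real.sqrt_nonneg b
  have hsum : t ≤ √(b + K) + √b := by nlinarith
  rw [← div_eq_mul_inv, le_div_iff₀ ht]
  nlinarith

/-- measure bound for the set `𝒢_K⁺`, `α > 1`. -/
theorem hyperbolic_level_set_plus_measure_bound (α : ℝ) (hα : 1 < α) :
    ∃ c : ℝ, 0 < c ∧ ∀ (n₀ : ℤ) (C K : ℝ), 0 < C → 1 ≤ K →
      ((volume : Measure ℝ).prod (Measure.count : Measure ℤ))
        {p : ℝ × ℤ |
          C ≤ p.1 ^ 2 - (1 / 2) * (|(p.2 : ℝ)| ^ (2 * α) + |((p.2 - n₀ : ℤ) : ℝ)| ^ (2 * α)) ∧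
          p.1 ^ 2 - (1 / 2) * (|(p.2 : ℝ)| ^ (2 * α) + |((p.2 - n₀ : ℤ) : ℝ)| ^ (2 * α)) ≤ C + K}
        ≤ ENNReal.ofReal (c * K) := by
  let g : ℤ → ℝ := fun n ↦ 2 * |(n : ℝ)| ^ (-α) + if n = 0 then 2 else 0
  have hg0 : ∀ n, 0 ≤ g n := fun n ↦ by positivity
  have hg : Summable g := ((Real.summable_abs_int_rpow hα).mul_left 2).add
    (summable_of_ne_finset_zero (s := {0}) fun n hn ↦ if_neg (by simpa using hn))
  have hgpos : 0 < g 0 := by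
    have : 0 ≤ |((0 : ℤ) : ℝ)| ^ (-α) := by positivity
    simp only [g, if_true]
    linarith
  refine ⟨∑' n, g n, hg.tsum_pos hg0 0 hgpos, fun n₀ C K hC hK ↦ ?_⟩
  have hA : Measurable fun p : ℝ × ℤ ↦
      p.1 ^ 2 - (1 / 2) * (|(p.2 : ℝ)| ^ (2 * α) + |((p.2 - n₀ : ℤ) : ℝ)| ^ (2 * α)) := by
    have h : Measurable fun n : ℤ ↦
        (1 / 2) * (|(n : ℝ)| ^ (2 * α) + |((n - n₀ : ℤ) : ℝ)| ^ (2 * α)) :=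
      measurable_from_top
    exact (measurable_fst.pow_const 2).sub (h.comp measurable_snd)
  rw [Measure.prod_apply_symm (by
      exact (measurableSet_le measurable_const hA).inter (measurableSet_le hA measurable_const)),
    lintegral_count, ← tsum_mul_right,
    ENNReal.ofReal_tsum_of_nonneg (fun n ↦ mul_nonneg (hg0 n) (by linarith)) (hg.mul_right K)]
  refine ENNReal.tsum_le_tsum fun n ↦ ?_
  set A : ℝ := (1 / 2) * (|(n : ℝ)| ^ (2 * α) + |((n - n₀ : ℤ) : ℝ)| ^ (2 * α)) with hAdef
  have hA₁ : |(n : ℝ)| ^ (2 * α) / 2 ≤ A := by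
    have : 0 ≤ |((n - n₀ : ℤ) : ℝ)| ^ (2 * α) := by positivity
    linarith
  have hA₀ : 0 ≤ A := by positivity
  calc volume {x : ℝ | C ≤ x ^ 2 - A ∧ x ^ 2 - A ≤ C + K}
      = volume {x : ℝ | A + C ≤ x ^ 2 ∧ x ^ 2 ≤ A + C + K} := by
        congr 1
        ext x
        exact and_congr ⟨fun h ↦ by linarith, fun h ↦ by linarith⟩
          ⟨fun h ↦ by linarith, fun h ↦ by linarith⟩
    _ ≤ ENNReal.ofReal (2 * (√(A + C + K) - √(A + C))) :=
        Real.volume_sq_mem_Icc_le (by linarith)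
    _ ≤ ENNReal.ofReal (g n * K) := by
        refine ENNReal.ofReal_le_ofReal ?_
        by_cases hn : n = 0
        · have h₀ := Real.sqrt_nonneg (A + C)
          have h₁ : √(A + C) ^ 2 = A + C := Real.sq_sqrt (by linarith)
          have h₂ : √(A + C + K) ≤ √(A + C) + K := Real.sqrt_le_iff.2
            ⟨by linarith, by nlinarith [mul_nonneg h₀ (zero_le_one.trans hK)]⟩
          have h₃ : 2 ≤ g n := by
            simp only [g, if_pos hn]
            have : 0 ≤ |(n : ℝ)| ^ (-α) := by positivity
            linarith
          nlinarith
        · have hpos : 0 < |(n : ℝ)| := by positivity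
          have hsq : (|(n : ℝ)| ^ α) ^ 2 = |(n : ℝ)| ^ (2 * α) := by
            rw [← Real.rpow_natCast, ← Real.rpow_mul hpos.le, mul_comm α]
            norm_num
          have h := Real.sqrt_add_sub_sqrt_le_of_sq_half_le (b := A + C) (K := K)
            (Real.rpow_pos_of_pos hpos α) (by linarith) (by rw [hsq]; linarith)
          simp only [g, if_neg hn, Real.rpow_neg hpos.le]
          linarith
end

section
/- Let α > 1. There exists a constant c > 0, depending only on α, such that for every C > 0 and every K ≥ 1 one has Σ_{n = ⌊(C+K)^{1/(2α)}⌋ + 1}^{∞} ( √(n^{2α} − C) − √(n^{2α} − C − K) ) ≤ c K. -/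
/-- For `y ≥ K + b ^ 2`, the increment of the square root over `[y - K, y]` is at most `K / b`. -/
theorem sqrt_sub_sqrt_sub_le_div {y K b : ℝ} (hK : 0 ≤ K) (hb : 0 < b) (hy : K + b ^ 2 ≤ y) :
    Real.sqrt y - Real.sqrt (y - K) ≤ K / b := by
  have h1 : b ≤ Real.sqrt (y - K) := Real.le_sqrt_of_sq_le (by linarith)
  have h2 := Real.sqrt_nonneg y
  have h3 : Real.sqrt (y - K) ≤ Real.sqrt y := Real.sqrt_le_sqrt (by linarith)
  have h4 : Real.sqrt y ^ 2 = y := Real.sq_sqrt (by nlinarith)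
  have h5 : Real.sqrt (y - K) ^ 2 = y - K := Real.sq_sqrt (by nlinarith)
  rw [le_div_iff₀ hb]
  nlinarith [mul_nonneg (sub_nonneg.2 h3) (by linarith :
    0 ≤ Real.sqrt y + Real.sqrt (y - K) - b)]

/-- For `K ≥ 1` and `y ≥ K`, the increment of the square root over `[y - K, y]` is at most `K`. -/
theorem sqrt_sub_sqrt_sub_le_self {y K : ℝ} (hK : 1 ≤ K) (hy : K ≤ y) :
    Real.sqrt y - Real.sqrt (y - K) ≤ K := by
  have h : Real.sqrt y ≤ Real.sqrt (y - K) + K := by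
    have h1 := Real.sqrt_nonneg (y - K)
    have h2 : Real.sqrt (y - K) ^ 2 = y - K := Real.sq_sqrt (by linarith)
    refine Real.sqrt_le_iff.2 ⟨by linarith, ?_⟩
    nlinarith [mul_nonneg h1 (by linarith : 0 ≤ K)]
  linarith

/-- the tail series `S₂⁻` is `≲_α K`. -/
theorem tail_series_sqrt_difference_bound (α : ℝ) (hα : 1 < α) :
    ∃ c : ℝ, 0 < c ∧ ∀ C K : ℝ, 0 < C → 1 ≤ K →
      (∑' m : ℕ,
          (Real.sqrt (((⌊(C + K) ^ (1 / (2 * α))⌋ + 1 + (m : ℤ) : ℤ) : ℝ) ^ (2 * α) - C) -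
            Real.sqrt (((⌊(C + K) ^ (1 / (2 * α))⌋ + 1 + (m : ℤ) : ℤ) : ℝ) ^ (2 * α) - C - K)))
        ≤ c * K := by
  set g : ℕ → ℝ := fun m => (if m = 0 then 1 else 0) + (m : ℝ) ^ (-α) with hg
  have hgs : Summable g :=
    (hasSum_ite_eq 0 (1 : ℝ)).summable.add (Real.summable_nat_rpow.2 (by linarith))
  have hg0 : ∀ m, 0 ≤ g m := fun m => by simp only [hg]; positivity
  refine ⟨1 + ∑' m, g m, add_pos_of_pos_of_nonneg one_pos (tsum_nonneg hg0), fun C K hC hK => ?_⟩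
  set x : ℝ := (C + K) ^ (1 / (2 * α)) with hx
  have hx0 : 0 ≤ x := by positivity
  have hxp : x ^ (2 * α) = C + K := by
    rw [hx, ← Real.rpow_mul (by linarith), one_div, inv_mul_cancel₀ (by linarith), Real.rpow_one]
  have key : ∀ m : ℕ, C + K + (m : ℝ) ^ (2 * α) ≤
      ((⌊x⌋ + 1 + (m : ℤ) : ℤ) : ℝ) ^ (2 * α) := fun m => by
    rw [← hxp]
    refine (Real.add_rpow_le_rpow_add hx0 m.cast_nonneg (by linarith)).trans ?_
    refine Real.rpow_le_rpow (by positivity) ?_ (by linarith)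
    push_cast
    linarith [Int.lt_floor_add_one x]
  have hle : ∀ m : ℕ,
      Real.sqrt (((⌊x⌋ + 1 + (m : ℤ) : ℤ) : ℝ) ^ (2 * α) - C) -
        Real.sqrt (((⌊x⌋ + 1 + (m : ℤ) : ℤ) : ℝ) ^ (2 * α) - C - K) ≤ g m * K := fun m => by
    have hk := key m
    rcases Nat.eq_zero_or_pos m with rfl | hm
    · have h1 : (0 : ℝ) ≤ ((0 : ℕ) : ℝ) ^ (2 * α) := by positivity
      refine (sqrt_sub_sqrt_sub_le_self hK (by linarith)).trans (le_of_eq ?_)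
      simp [hg, Real.zero_rpow (by linarith : -α ≠ 0)]
    · have hm' : (0 : ℝ) < m := by exact_mod_cast hm
      have h2 : ((m : ℝ) ^ α) ^ 2 = (m : ℝ) ^ (2 * α) := by
        rw [← Real.rpow_natCast, ← Real.rpow_mul hm'.le, mul_comm]; norm_num
      refine (sqrt_sub_sqrt_sub_le_div (b := (m : ℝ) ^ α) (by linarith) (by positivity)
        (by linarith)).trans (le_of_eq ?_)
      simp [hg, hm.ne', Real.rpow_neg hm'.le, div_eq_inv_mul]
  have hnonneg : ∀ m : ℕ, 0 ≤
      Real.sqrt (((⌊x⌋ + 1 + (m : ℤ) : ℤ) : ℝ) ^ (2 * α) - C) -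
        Real.sqrt (((⌊x⌋ + 1 + (m : ℤ) : ℤ) : ℝ) ^ (2 * α) - C - K) := fun m =>
    sub_nonneg.2 (Real.sqrt_le_sqrt (by linarith))
  have hs := hgs.mul_right K
  calc _ ≤ ∑' m, g m * K := (hs.of_nonneg_of_le hnonneg hle).tsum_le_tsum hle hs
    _ = (∑' m, g m) * K := tsum_mul_right
    _ ≤ _ := by nlinarith
end

section
/- Let α > 1. There exists a constant c > 0, depending only on α, such that for every C > 0 and every K ≥ 1 one has ∫_{C^{1/(2α)}}^{(C+K)^{1/(2α)}} √(z^{2α} − C) dz ≤ c K. -/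
open MeasureTheory

/-- the integral `𝒥₁` is `≲_α K`. -/
theorem integral_sqrt_bound (α : ℝ) (hα : 1 < α) :
    ∃ c : ℝ, 0 < c ∧ ∀ C K : ℝ, 0 < C → 1 ≤ K →
      (∫⁻ z in Set.Icc (C ^ (1 / (2 * α))) ((C + K) ^ (1 / (2 * α))),
          ENNReal.ofReal (Real.sqrt (z ^ (2 * α) - C)))
        ≤ ENNReal.ofReal (c * K) := by
  refine ⟨1, one_pos, fun C K hC hK => ?_⟩
  have hK0 : 0 < K := by linarith
  have hp0 : 0 ≤ 1 / (2 * α) := by positivity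
  have hp : 1 / (2 * α) ≤ 1 / 2 := by gcongr; linarith
  have hsub : (C + K) ^ (1 / (2 * α)) - C ^ (1 / (2 * α)) ≤ √K := by
    have h1 := Real.rpow_add_le_add_rpow hC.le hK0.le hp0 (by linarith)
    have h2 := Real.rpow_le_rpow_of_exponent_le hK hp
    rw [← Real.sqrt_eq_rpow] at h2
    linarith
  calc
    _ ≤ ∫⁻ _ in Set.Icc (C ^ (1 / (2 * α))) ((C + K) ^ (1 / (2 * α))), ENNReal.ofReal √K := by
      refine setLIntegral_mono' measurableSet_Icc fun z hz => ?_
      have hz0 : 0 ≤ z := (Real.rpow_nonneg hC.le _).trans hz.1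
      have hzK : z ^ (2 * α) ≤ C + K := by
        rw [one_div] at hz
        exact (Real.le_rpow_inv_iff_of_pos hz0 (by positivity) (by positivity)).1 hz.2
      gcongr
      linarith
    _ = ENNReal.ofReal (√K * ((C + K) ^ (1 / (2 * α)) - C ^ (1 / (2 * α)))) := by
      rw [setLIntegral_const, Real.volume_Icc, ENNReal.ofReal_mul (Real.sqrt_nonneg _)]
    _ ≤ ENNReal.ofReal (1 * K) := by
      refine ENNReal.ofReal_le_ofReal ?_
      calc
        _ ≤ √K * √K := by gcongr
        _ = 1 * K := by rw [Real.mul_self_sqrt hK0.le, one_mul]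
end

section
/- Let α > 1. There exists a constant c > 0, depending only on α, such that for every C > 0 and every K ≥ 1 one has ∫_{(C+K)^{1/(2α)}}^{∞} (z^{2α} − C)^{−1/2} dz ≤ c. -/
open MeasureTheory

/-- Superadditivity of `x ↦ x ^ p` for `1 ≤ p`, written as a lower bound for `z ^ p - b ^ p`. -/
theorem rpow_sub_le_rpow_sub_rpow {p b z : ℝ} (hp : 1 ≤ p) (hb : 0 ≤ b) (hz : b ≤ z) :
    (z - b) ^ p ≤ z ^ p - b ^ p := by
  have h := NNReal.add_rpow_le_rpow_add (⟨z - b, sub_nonneg.2 hz⟩ : NNReal) ⟨b, hb⟩ hp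
  have h' : (z - b) ^ p + b ^ p ≤ (z - b + b) ^ p := by exact_mod_cast h
  rw [sub_add_cancel] at h'
  linarith

theorem lintegral_Ioi_one_rpow_neg {α : ℝ} (hα : 1 < α) :
    ∫⁻ t in Set.Ioi (1 : ℝ), ENNReal.ofReal (t ^ (-α)) = ENNReal.ofReal (1 / (α - 1)) := by
  rw [← ofReal_integral_eq_lintegral_ofReal
    (integrableOn_Ioi_rpow_of_lt (by linarith) one_pos)]
  · rw [integral_Ioi_rpow_of_lt (by linarith) one_pos, Real.one_rpow,
      show -α + 1 = -(α - 1) by ring, neg_div_neg_eq]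
  · exact ae_restrict_of_forall_mem measurableSet_Ioi fun t ht =>
      Real.rpow_nonneg (zero_le_one.trans (le_of_lt ht)) _

/-- the integral `𝒥₂/K` is bounded uniformly in `C, K`. -/
theorem integral_inv_sqrt_tail_bound (α : ℝ) (hα : 1 < α) :
    ∃ c : ℝ, 0 < c ∧ ∀ C K : ℝ, 0 < C → 1 ≤ K →
      (∫⁻ z in Set.Ici ((C + K) ^ (1 / (2 * α))),
          ENNReal.ofReal (1 / Real.sqrt (z ^ (2 * α) - C)))
        ≤ ENNReal.ofReal c := by
  have hα' : 0 < 1 / (α - 1) := one_div_pos.2 (by linarith)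
  refine ⟨1 + 1 / (α - 1), by positivity, fun C K hC hK => ?_⟩
  have hp : 0 < 2 * α := by linarith
  set b := C ^ (1 / (2 * α)) with hb
  have hb0 : 0 < b := Real.rpow_pos_of_pos hC _
  have hbC : b ^ (2 * α) = C := by
    rw [hb, ← Real.rpow_mul hC.le, one_div_mul_cancel hp.ne', Real.rpow_one]
  let g : ℝ → ENNReal := fun t =>
    (Set.Icc (0 : ℝ) 1).indicator 1 t +
      (Set.Ioi (1 : ℝ)).indicator (fun t => ENNReal.ofReal (t ^ (-α))) t
  have hfg : ∀ z ∈ Set.Ici ((C + K) ^ (1 / (2 * α))),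
      ENNReal.ofReal (1 / Real.sqrt (z ^ (2 * α) - C)) ≤ g (z - b) := by
    intro z hz
    have hbz : b ≤ z :=
      (Real.rpow_le_rpow hC.le (by linarith) (one_div_pos.2 hp).le).trans hz
    have hCK : C + K ≤ z ^ (2 * α) := by
      have := Real.rpow_le_rpow (Real.rpow_nonneg (by linarith) _) (Set.mem_Ici.1 hz) hp.le
      rwa [← Real.rpow_mul (by linarith), one_div_mul_cancel hp.ne', Real.rpow_one] at this
    by_cases h : z - b ≤ 1
    · have hmem : z - b ∈ Set.Icc (0 : ℝ) 1 := ⟨sub_nonneg.2 hbz, h⟩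
      refine le_trans ?_ le_self_add
      rw [Set.indicator_of_mem hmem, Pi.one_apply, ENNReal.ofReal_le_one]
      exact div_le_one_of_le₀ (Real.one_le_sqrt.2 (by linarith)) (Real.sqrt_nonneg _)
    · have hmem : z - b ∈ Set.Ioi (1 : ℝ) := not_le.1 h
      have hpos : 0 < z - b := zero_lt_one.trans hmem
      refine le_trans ?_ le_add_self
      rw [Set.indicator_of_mem hmem]
      refine ENNReal.ofReal_le_ofReal ?_
      rw [Real.rpow_neg hpos.le, ← one_div]
      refine one_div_le_one_div_of_le (Real.rpow_pos_of_pos hpos _) (Real.le_sqrt_of_sq_le ?_)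
      have := rpow_sub_le_rpow_sub_rpow (p := 2 * α) (by linarith) hb0.le hbz
      rwa [hbC, mul_comm 2 α, Real.rpow_mul hpos.le, Real.rpow_two, mul_comm α 2] at this
  calc _ ≤ ∫⁻ z in Set.Ici ((C + K) ^ (1 / (2 * α))), g (z - b) :=
        setLIntegral_mono' measurableSet_Ici hfg
    _ ≤ ∫⁻ z, g (z - b) := setLIntegral_le_lintegral _ _
    _ = ∫⁻ t, g t := lintegral_sub_right_eq_self g b
    _ = ENNReal.ofReal (1 + 1 / (α - 1)) := by
      rw [lintegral_add_left (measurable_one.indicator measurableSet_Icc),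
        lintegral_indicator_one measurableSet_Icc, lintegral_indicator measurableSet_Ioi,
        lintegral_Ioi_one_rpow_neg hα, Real.volume_Icc, sub_zero,
        ENNReal.ofReal_add zero_le_one hα'.le]
end

section
/- Let α ≥ 1. There exists a constant c > 0, depending only on α, such that for every ξ₀ ∈ ℝ, every n₀ ∈ ℤ, every C ≥ 1 and every K ≥ 1, the set 𝒢̃_K = { (ξ, n) ∈ ℝ × ℤ : C ≤ (ξ − ξ₀)² + (1/2)(|n|^{2α} + |n − n₀|^{2α}) ≤ C + K } satisfies 𝔪(𝒢̃_K) ≤ c K. -/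
open MeasureTheory

/-- A discrete tangent-line inequality for `x ↦ x ^ α` on the nonnegative integers, with a slope that
is at least `1`. -/
lemma rpow_tangent_le_of_int {α : ℝ} (hα : 1 ≤ α) {x y : ℤ} (hx : 0 ≤ x) (hy : 0 ≤ y) :
    (x : ℝ) ^ α + max 1 (α * (x : ℝ) ^ (α - 1)) * ((y : ℝ) - x) ≤ (y : ℝ) ^ α := by
  have one_le : ∀ {z : ℤ}, 1 ≤ z → (1 : ℝ) ≤ z := fun h => by exact_mod_cast h
  rcases hx.eq_or_lt with rfl | hx
  · have hmax : max 1 (α * ((0 : ℤ) : ℝ) ^ (α - 1)) = 1 := by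
      rcases hα.eq_or_lt with rfl | h
      · simp
      · simp [Real.zero_rpow (sub_pos.2 h).ne']
    rw [hmax]
    rcases hy.eq_or_lt with rfl | hy
    · simp
    · have h1 := one_le (Int.add_one_le_iff.2 hy)
      have := Real.self_le_rpow_of_one_le h1 hα
      simpa [Real.zero_rpow (by linarith : α ≠ 0)] using this
  · have hx1 := one_le (Int.add_one_le_iff.2 hx)
    have hx0 : (0 : ℝ) < x := by linarith
    have hy0 : (0 : ℝ) ≤ y := by exact_mod_cast hy
    have hpow : 1 ≤ (x : ℝ) ^ (α - 1) := Real.one_le_rpow hx1 (by linarith)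
    rw [max_eq_right (by nlinarith)]
    have hB := one_add_mul_self_le_rpow_one_add (s := (y : ℝ) / x - 1)
      (by linarith [div_nonneg hy0 hx0.le]) hα
    rw [add_sub_cancel, Real.div_rpow hy0 hx0.le, le_div_iff₀ (by positivity)] at hB
    rw [Real.rpow_sub_one hx0.ne']
    calc _ = (1 + α * ((y : ℝ) / x - 1)) * (x : ℝ) ^ α := by field_simp
      _ ≤ _ := hB

lemma rpow_add_rpow_add_le_of_int {α : ℝ} (hα : 1 ≤ α) {p q p' q' : ℤ} (hq : 0 ≤ q)
    (hqp : q ≤ p) (hp : p ≤ p') (hq' : 0 ≤ q') (hsum : p + q ≤ p' + q') :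
    (p : ℝ) ^ α + (q : ℝ) ^ α + ((p' : ℝ) + q' - (p + q)) ≤ (p' : ℝ) ^ α + (q' : ℝ) ^ α := by
  have h1 := rpow_tangent_le_of_int hα (hq.trans hqp) ((hq.trans hqp).trans hp)
  have h2 := rpow_tangent_le_of_int hα hq hq'
  have hσ : max 1 (α * (q : ℝ) ^ (α - 1)) ≤ max 1 (α * (p : ℝ) ^ (α - 1)) := by
    have hq0 : (0 : ℝ) ≤ q := by exact_mod_cast hq
    have hqp0 : (q : ℝ) ≤ p := by exact_mod_cast hqp
    gcongr
  have hσ1 : 1 ≤ max 1 (α * (q : ℝ) ^ (α - 1)) := le_max_left _ _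
  generalize max 1 (α * (q : ℝ) ^ (α - 1)) = s at *
  generalize max 1 (α * (p : ℝ) ^ (α - 1)) = t at *
  have hp0 : (p : ℝ) ≤ p' := by exact_mod_cast hp
  have hs0 : (p : ℝ) + q ≤ p' + q' := by exact_mod_cast hsum
  rcases le_total q q' with h | h
  · have h0 : (q : ℝ) ≤ q' := by exact_mod_cast h
    nlinarith
  · have h0 : (q' : ℝ) ≤ q := by exact_mod_cast h
    nlinarith

/-- The average of two powers along the integers at distance `k` (up to parity) from the centre of
symmetry grows at least quadratically in `k`. -/
lemma sq_sub_sq_le_rpow_average_sub {α : ℝ} (hα : 1 ≤ α) (r e : ℤ) (he : 0 ≤ e) (he1 : e ≤ 1)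
    {j k : ℕ} (hjk : j ≤ k) :
    (k : ℝ) ^ 2 - (j : ℝ) ^ 2 ≤
      (1 / 2) * (|((r + e + k : ℤ) : ℝ)| ^ (2 * α) + |((r - k : ℤ) : ℝ)| ^ (2 * α)) -
      (1 / 2) * (|((r + e + j : ℤ) : ℝ)| ^ (2 * α) + |((r - j : ℤ) : ℝ)| ^ (2 * α)) := by
  have hpow : ∀ x : ℤ, |(x : ℝ)| ^ (2 * α) = ((x ^ 2 : ℤ) : ℝ) ^ α := fun x => by
    rw [Real.rpow_mul (abs_nonneg _), Real.rpow_two, sq_abs, Int.cast_pow]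
  simp only [hpow]
  have hj : (0 : ℤ) ≤ j := by positivity
  have hjk' : (j : ℤ) ≤ k := by exact_mod_cast hjk
  have hsum : (r + e + j) ^ 2 + (r - j) ^ 2 + 2 * ((k : ℤ) ^ 2 - j ^ 2) ≤
      (r + e + k) ^ 2 + (r - k) ^ 2 := by nlinarith [mul_nonneg he (sub_nonneg.2 hjk')]
  have hsq : (j : ℤ) ^ 2 ≤ k ^ 2 := by gcongr
  have hsumR : (((r + e + j) ^ 2 : ℤ) : ℝ) + ((r - j) ^ 2 : ℤ) + 2 * ((k : ℝ) ^ 2 - j ^ 2) ≤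
      ((r + e + k) ^ 2 : ℤ) + ((r - k) ^ 2 : ℤ) := by exact_mod_cast hsum
  rcases le_or_gt 0 r with hr | hr
  · have := rpow_add_rpow_add_le_of_int hα (p := (r + e + j) ^ 2) (q := (r - j) ^ 2)
      (p' := (r + e + k) ^ 2) (q' := (r - k) ^ 2) (sq_nonneg _)
      (sq_le_sq' (by linarith) (by linarith)) (by gcongr) (sq_nonneg _) (by linarith)
    linarith
  · have := rpow_add_rpow_add_le_of_int hα (p := (r - j) ^ 2) (q := (r + e + j) ^ 2)
      (p' := (r - k) ^ 2) (q' := (r + e + k) ^ 2) (sq_nonneg _)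
      (by rw [sq_le_sq, abs_of_neg (by linarith : r - j < 0), abs_le]; constructor <;> linarith)
      (by rw [sq_le_sq, abs_of_neg (by linarith : r - j < 0), abs_of_neg (by linarith : r - k < 0)]
          linarith) (sq_nonneg _) (by linarith)
    linarith

lemma sqrt_add_sub_sqrt_le_sqrt {K : ℝ} (hK : 0 ≤ K) (A : ℝ) :
    √(A + K) - √A ≤ √K := by
  rcases le_total 0 A with hA | hA
  · rw [sub_le_iff_le_add, Real.sqrt_le_left (by positivity)]
    nlinarith [Real.sq_sqrt hA, Real.sq_sqrt hK, Real.sqrt_nonneg A, Real.sqrt_nonneg K,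
      mul_nonneg (Real.sqrt_nonneg A) (Real.sqrt_nonneg K)]
  · have := Real.sqrt_le_sqrt (by linarith : A + K ≤ K)
    linarith [Real.sqrt_nonneg A]

lemma sqrt_add_sub_sqrt_le_div {K A B : ℝ} (hK : 0 ≤ K) (hB : 0 < B) (hBA : B ≤ A) :
    √(A + K) - √A ≤ K / √B := by
  have hsB := Real.sqrt_pos.2 hB
  have hle := Real.sqrt_le_sqrt hBA
  have hle' := Real.sqrt_le_sqrt (by linarith : A ≤ A + K)
  rw [le_div_iff₀ hsB]
  have h1 := Real.sq_sqrt (by linarith : 0 ≤ A)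
  have h2 := Real.sq_sqrt (by linarith : 0 ≤ A + K)
  nlinarith

lemma sum_range_inv_sqrt_le (T : ℕ) :
    ∑ j ∈ Finset.range T, 1 / √((j : ℝ) + 1) ≤ 2 * √(T : ℝ) := by
  induction T with
  | zero => simp
  | succ T ih =>
    rw [Finset.sum_range_succ, Nat.cast_succ]
    have hpos : 0 < √((T : ℝ) + 1) := Real.sqrt_pos.2 (by positivity)
    have h1 := Real.sq_sqrt (by positivity : (0 : ℝ) ≤ T)
    have h2 := Real.sq_sqrt (by positivity : (0 : ℝ) ≤ (T : ℝ) + 1)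
    have : 1 / √((T : ℝ) + 1) ≤ 2 * (√((T : ℝ) + 1) - √(T : ℝ)) := by
      rw [div_le_iff₀ hpos]
      nlinarith [sq_nonneg (√((T : ℝ) + 1) - √(T : ℝ))]
    linarith

/-- If all terms `u k`, `k < S`, are at most `C`, the corresponding gaps sum to `O(K)`. -/
lemma sum_range_sqrt_gap_le_of_le {u : ℕ → ℝ} {C K : ℝ} (hK : 1 ≤ K)
    (hu : ∀ j k : ℕ, j ≤ k → (k : ℝ) ^ 2 - (j : ℝ) ^ 2 ≤ u k - u j) {S : ℕ}
    (hS : ∀ k < S, u k ≤ C) :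
    ∑ k ∈ Finset.range S, (√(C - u k + K) - √(C - u k)) ≤ 3 * K := by
  have hK0 : 0 ≤ K := by linarith
  have hsK : √K ≤ K := (Real.sqrt_le_left hK0).2 (by nlinarith)
  rcases S with _ | T
  · simp; linarith
  rw [← Finset.sum_range_reflect, Finset.sum_range_succ']
  have hterm : ∀ j ∈ Finset.range T,
      √(C - u (T + 1 - 1 - (j + 1)) + K) - √(C - u (T + 1 - 1 - (j + 1))) ≤
        K / √(T : ℝ) * (1 / √((j : ℝ) + 1)) := by
    intro j hj
    rw [Finset.mem_range] at hj
    have hT : (0 : ℝ) < T := by exact_mod_cast (by omega : 0 < T)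
    have hjT : (j : ℝ) + 1 ≤ T := by exact_mod_cast hj
    have hcast : ((T + 1 - 1 - (j + 1) : ℕ) : ℝ) = T - (j + 1) := by
      rw [Nat.add_sub_cancel, Nat.cast_sub hj]; push_cast; ring
    have h1 := hu (T + 1 - 1 - (j + 1)) T (by omega)
    rw [hcast] at h1
    have h2 := hS T (by omega)
    have hj0 : (0 : ℝ) < (j : ℝ) + 1 := by positivity
    have := sqrt_add_sub_sqrt_le_div (A := C - u (T + 1 - 1 - (j + 1))) hK0
      (mul_pos hT hj0) (by nlinarith)
    rwa [Real.sqrt_mul hT.le, ← div_div, div_eq_mul_one_div (K / _)] at this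
  have hsum := Finset.sum_le_sum hterm
  rw [← Finset.mul_sum] at hsum
  have hlast := sqrt_add_sub_sqrt_le_sqrt hK0 (C - u (T + 1 - 1 - 0))
  have hmain : K / √(T : ℝ) * ∑ j ∈ Finset.range T, 1 / √((j : ℝ) + 1) ≤ 2 * K := by
    calc _ ≤ K / √(T : ℝ) * (2 * √(T : ℝ)) := by
          gcongr
          exact sum_range_inv_sqrt_le T
      _ = 2 * K * (√(T : ℝ) / √(T : ℝ)) := by ring
      _ ≤ 2 * K * 1 := by gcongr; exact div_self_le_one _
      _ = 2 * K := mul_one _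
  linarith

lemma tsum_ofReal_sqrt_gap_le {u : ℕ → ℝ} {C K : ℝ} (hK : 1 ≤ K)
    (hu : ∀ j k : ℕ, j ≤ k → (k : ℝ) ^ 2 - (j : ℝ) ^ 2 ≤ u k - u j) :
    ∑' k, ENNReal.ofReal (√(C - u k + K) - √(C - u k)) ≤ ENNReal.ofReal (5 * K) := by
  classical
  have hK0 : 0 ≤ K := by linarith
  have hex : ∃ k, C < u k := by
    obtain ⟨n, hn⟩ := exists_nat_gt (max 1 (C - u 0))
    have h1 := (le_max_left _ _).trans_lt hn
    have h2 := (le_max_right _ _).trans_lt hn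
    have h3 := hu 0 n (Nat.zero_le _)
    refine ⟨n, ?_⟩
    norm_num at h3
    nlinarith
  obtain ⟨S, hSC, hSmin⟩ : ∃ S, C < u S ∧ ∀ k < S, u k ≤ C :=
    ⟨Nat.find hex, Nat.find_spec hex, fun k hk => not_lt.1 (Nat.find_min hex hk)⟩
  have hsK1 : 1 ≤ √K := Real.one_le_sqrt.2 hK
  have hupper : ∀ i : ℕ, C + (i : ℝ) ^ 2 ≤ u (S + i) := by
    intro i
    have h := hu S (S + i) (by omega)
    push_cast at h
    nlinarith [mul_nonneg (Nat.cast_nonneg (α := ℝ) S) (Nat.cast_nonneg (α := ℝ) i)]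
  rw [tsum_eq_sum (s := Finset.range (S + ⌈√K⌉₊))]
  · rw [← ENNReal.ofReal_sum_of_nonneg
      (fun k _ => sub_nonneg.2 (Real.sqrt_le_sqrt (by linarith)))]
    apply ENNReal.ofReal_le_ofReal
    rw [Finset.sum_range_add]
    have h1 := sum_range_sqrt_gap_le_of_le hK hu hSmin
    have h2 : ∑ i ∈ Finset.range ⌈√K⌉₊, (√(C - u (S + i) + K) - √(C - u (S + i))) ≤
        ⌈√K⌉₊ * √K := by
      simpa using Finset.sum_le_card_nsmul (Finset.range ⌈√K⌉₊) _ (√K)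
        (fun i _ => sqrt_add_sub_sqrt_le_sqrt hK0 (C - u (S + i)))
    have h3 := Nat.ceil_lt_add_one (Real.sqrt_nonneg K)
    nlinarith [Real.sq_sqrt hK0]
  · intro k hk
    rw [Finset.mem_range, not_lt] at hk
    obtain ⟨i, rfl⟩ := Nat.exists_eq_add_of_le (show S ≤ k by omega)
    have hi : √K ≤ i := Nat.ceil_le.1 (by omega)
    have hi2 : K ≤ (i : ℝ) ^ 2 := by nlinarith [Real.sq_sqrt hK0]
    have := hupper i
    rw [Real.sqrt_eq_zero_of_nonpos (by linarith), Real.sqrt_eq_zero_of_nonpos (by linarith)]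
    simp

lemma volume_setOf_sq_mem_Icc_le (x₀ A K : ℝ) :
    volume {x : ℝ | A ≤ (x - x₀) ^ 2 ∧ (x - x₀) ^ 2 ≤ A + K} ≤
      2 * ENNReal.ofReal (√(A + K) - √A) := by
  have hsub : {x : ℝ | A ≤ (x - x₀) ^ 2 ∧ (x - x₀) ^ 2 ≤ A + K} ⊆
      Set.Icc (x₀ + √A) (x₀ + √(A + K)) ∪ Set.Icc (x₀ - √(A + K)) (x₀ - √A) := by
    rintro x ⟨h1, h2⟩
    have h1' : √A ≤ |x - x₀| := Real.sqrt_sq_eq_abs (x - x₀) ▸ Real.sqrt_le_sqrt h1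
    have h2' : |x - x₀| ≤ √(A + K) := Real.sqrt_sq_eq_abs (x - x₀) ▸ Real.sqrt_le_sqrt h2
    rcases le_total 0 (x - x₀) with h | h
    · rw [abs_of_nonneg h] at h1' h2'
      exact Or.inl ⟨by linarith, by linarith⟩
    · rw [abs_of_nonpos h] at h1' h2'
      exact Or.inr ⟨by linarith, by linarith⟩
  refine (measure_mono hsub).trans ((measure_union_le _ _).trans_eq ?_)
  rw [Real.volume_Icc, Real.volume_Icc, two_mul]
  congr 2 <;> ring

/-- elliptic level-set measure bound, `α ≥ 1`. -/
theorem elliptic_level_set_measure_bound (α : ℝ) (hα : 1 ≤ α) :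
    ∃ c : ℝ, 0 < c ∧ ∀ (ξ₀ : ℝ) (n₀ : ℤ) (C K : ℝ), 1 ≤ C → 1 ≤ K →
      ((volume : Measure ℝ).prod (Measure.count : Measure ℤ))
        {p : ℝ × ℤ |
          C ≤ (p.1 - ξ₀) ^ 2 +
                (1 / 2) * (|(p.2 : ℝ)| ^ (2 * α) + |((p.2 - n₀ : ℤ) : ℝ)| ^ (2 * α)) ∧
          (p.1 - ξ₀) ^ 2 +
                (1 / 2) * (|(p.2 : ℝ)| ^ (2 * α) + |((p.2 - n₀ : ℤ) : ℝ)| ^ (2 * α)) ≤ C + K}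
        ≤ ENNReal.ofReal (c * K) := by
  refine ⟨20, by norm_num, fun ξ₀ n₀ C K _ hK => ?_⟩
  have hmeas : MeasurableSet {p : ℝ × ℤ |
          C ≤ (p.1 - ξ₀) ^ 2 +
                (1 / 2) * (|(p.2 : ℝ)| ^ (2 * α) + |((p.2 - n₀ : ℤ) : ℝ)| ^ (2 * α)) ∧
          (p.1 - ξ₀) ^ 2 +
                (1 / 2) * (|(p.2 : ℝ)| ^ (2 * α) + |((p.2 - n₀ : ℤ) : ℝ)| ^ (2 * α)) ≤ C + K} := by
    have hF : Measurable fun p : ℝ × ℤ => (p.1 - ξ₀) ^ 2 +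
        (1 / 2) * (|(p.2 : ℝ)| ^ (2 * α) + |((p.2 - n₀ : ℤ) : ℝ)| ^ (2 * α)) := by
      have hG : Measurable fun n : ℤ =>
          (1 / 2) * (|(n : ℝ)| ^ (2 * α) + |((n - n₀ : ℤ) : ℝ)| ^ (2 * α)) :=
        measurable_of_countable _
      exact ((measurable_fst.sub_const ξ₀).pow_const 2).add (hG.comp measurable_snd)
    exact (measurableSet_le measurable_const hF).inter (measurableSet_le hF measurable_const)
  rw [Measure.prod_apply_symm hmeas, lintegral_count]
  set F : ℤ → ℝ := fun n => (1 / 2) * (|(n : ℝ)| ^ (2 * α) + |((n - n₀ : ℤ) : ℝ)| ^ (2 * α))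
    with hFdef
  have hsection : ∀ n : ℤ, volume ((fun x : ℝ => (x, n)) ⁻¹' {p : ℝ × ℤ |
          C ≤ (p.1 - ξ₀) ^ 2 +
                (1 / 2) * (|(p.2 : ℝ)| ^ (2 * α) + |((p.2 - n₀ : ℤ) : ℝ)| ^ (2 * α)) ∧
          (p.1 - ξ₀) ^ 2 +
                (1 / 2) * (|(p.2 : ℝ)| ^ (2 * α) + |((p.2 - n₀ : ℤ) : ℝ)| ^ (2 * α)) ≤ C + K}) ≤
      2 * ENNReal.ofReal (√(C - F n + K) - √(C - F n)) := by
    intro n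
    refine (measure_mono ?_).trans (volume_setOf_sq_mem_Icc_le ξ₀ (C - F n) K)
    rintro x ⟨h1, h2⟩
    simp only at h1 h2
    constructor <;> simp only [hFdef] <;> linarith
  refine (ENNReal.tsum_le_tsum hsection).trans ?_
  rw [ENNReal.tsum_mul_left]
  obtain ⟨r, e, he, he1, hn₀⟩ : ∃ r e : ℤ, 0 ≤ e ∧ e ≤ 1 ∧ n₀ = 2 * r + e :=
    ⟨n₀ / 2, n₀ % 2, by omega, by omega, by omega⟩
  set u : ℕ → ℝ := fun k =>
    (1 / 2) * (|((r + e + k : ℤ) : ℝ)| ^ (2 * α) + |((r - k : ℤ) : ℝ)| ^ (2 * α)) with hu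
  have hup : ∀ k : ℕ, F (r + e + k) = u k := by
    intro k
    simp only [hFdef, hu]
    rw [show r + e + (k : ℤ) - n₀ = -(r - k) by rw [hn₀]; ring, Int.cast_neg, abs_neg]
  have hdown : ∀ k : ℕ, F (r - k) = u k := by
    intro k
    simp only [hFdef, hu]
    rw [show r - (k : ℤ) - n₀ = -(r + e + k) by rw [hn₀]; ring, Int.cast_neg, abs_neg, add_comm]
  have hsurj : Function.Surjective
      (Sum.elim (fun k : ℕ => r + e + (k : ℤ)) (fun k : ℕ => r - (k : ℤ))) := by
    intro n
    rcases le_or_gt n r with h | h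
    · exact ⟨Sum.inr (r - n).toNat, by simp only [Sum.elim_inr]; omega⟩
    · exact ⟨Sum.inl (n - r - e).toNat, by simp only [Sum.elim_inl]; omega⟩
  have hgap := tsum_ofReal_sqrt_gap_le (C := C) hK
    (fun j k hjk => sq_sub_sq_le_rpow_average_sub hα r e he he1 hjk : ∀ j k : ℕ, j ≤ k →
      (k : ℝ) ^ 2 - (j : ℝ) ^ 2 ≤ u k - u j)
  have htotal := ENNReal.tsum_le_tsum_comp_of_surjective hsurj
    (fun n => ENNReal.ofReal (√(C - F n + K) - √(C - F n)))
  rw [Summable.tsum_sum ENNReal.summable ENNReal.summable] at htotal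
  simp only [Sum.elim_inl, Sum.elim_inr, hup, hdown] at htotal
  calc _ ≤ 2 * (ENNReal.ofReal (5 * K) + ENNReal.ofReal (5 * K)) := by
        gcongr
        exact htotal.trans (add_le_add hgap hgap)
    _ = ENNReal.ofReal (20 * K) := by
        rw [← ENNReal.ofReal_add (by linarith) (by linarith),
          show (2 : ENNReal) = ENNReal.ofReal 2 by simp, ← ENNReal.ofReal_mul (by norm_num)]
        congr 1
        ring
end

section
/- Let 0 < α < 1. Then for every M > 0 there exists C ≥ 1 such that the set { (ξ, n) ∈ ℝ × ℤ : C ≤ ξ² + |n|^{2α} ≤ C + 1 } has 𝔪-measure at least M. Consequently, for 0 < α < 1 there is no constant c with 𝔪(𝒢̃_K) ≤ c K uniformly over all C ≥ 1 and K ≥ 1, i.e. the elliptic level-set lemma fails for 0 < α < 1. -/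
open MeasureTheory

/-- The interval between the square roots of `x` and `x + 1` is not shorter than `1 / (3 * R)`
when `0 ≤ x ≤ R ^ 2` and `1 ≤ R`. -/
lemma one_div_three_mul_le_sqrt_add_one_sub_sqrt {x R : ℝ} (hx : 0 ≤ x) (hxR : x ≤ R ^ 2)
    (hR : 1 ≤ R) : 1 / (3 * R) ≤ √(x + 1) - √x := by
  have h1 : √x ≤ R := Real.sqrt_le_iff.2 ⟨by linarith, hxR⟩
  have h2 : √(x + 1) ≤ 2 * R := Real.sqrt_le_iff.2 ⟨by linarith, by nlinarith⟩
  have h3 := Real.sq_sqrt hx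
  have h4 := Real.sq_sqrt (by linarith : (0 : ℝ) ≤ x + 1)
  have h5 : √x ≤ √(x + 1) := Real.sqrt_le_sqrt (by linarith)
  rw [div_le_iff₀ (by linarith)]
  nlinarith [mul_nonneg (sub_nonneg.2 h5) (by linarith : 0 ≤ 3 * R - (√(x + 1) + √x))]

/-- The slice `C ≤ ξ ^ 2 + a ≤ C + 1` has length at least `1 / (3 * R)` when `0 ≤ a ≤ C = R ^ 2`. -/
lemma ofReal_le_volume_slice {a R : ℝ} (ha : 0 ≤ a) (haR : a ≤ R ^ 2) (hR : 1 ≤ R) :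
    ENNReal.ofReal (1 / (3 * R)) ≤
      volume {ξ : ℝ | R ^ 2 ≤ ξ ^ 2 + a ∧ ξ ^ 2 + a ≤ R ^ 2 + 1} := by
  have hx : 0 ≤ R ^ 2 - a := sub_nonneg.2 haR
  calc ENNReal.ofReal (1 / (3 * R))
      ≤ ENNReal.ofReal (√(R ^ 2 - a + 1) - √(R ^ 2 - a)) :=
        ENNReal.ofReal_le_ofReal
          (one_div_three_mul_le_sqrt_add_one_sub_sqrt hx (by linarith) hR)
    _ = volume (Set.Icc (√(R ^ 2 - a)) (√(R ^ 2 - a + 1))) := Real.volume_Icc.symm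
    _ ≤ _ := by
        refine measure_mono fun ξ hξ => ?_
        have h0 : 0 ≤ ξ := (Real.sqrt_nonneg _).trans hξ.1
        have h1 := (Real.sqrt_le_left h0).1 hξ.1
        have h2 := (Real.le_sqrt h0 (by linarith)).1 hξ.2
        exact ⟨by linarith, by linarith⟩

/-- for `0 < α < 1` the elliptic level sets (with `K = 1`) have arbitrarily
large measure, so the elliptic level-set lemma fails. -/
theorem elliptic_level_set_unbounded_measure (α : ℝ) (hα0 : 0 < α) (hα1 : α < 1) :
    ∀ M : ℝ, 0 < M → ∃ C : ℝ, 1 ≤ C ∧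
      ENNReal.ofReal M ≤
        ((volume : Measure ℝ).prod (Measure.count : Measure ℤ))
          {p : ℝ × ℤ |
            C ≤ p.1 ^ 2 + |(p.2 : ℝ)| ^ (2 * α) ∧ p.1 ^ 2 + |(p.2 : ℝ)| ^ (2 * α) ≤ C + 1} := by
  intro M hM
  obtain ⟨N, hN1, hNM⟩ : ∃ N : ℕ, 1 ≤ N ∧ 3 * M ≤ (N : ℝ) ^ (1 - α) := by
    have h := (tendsto_rpow_atTop (sub_pos.2 hα1)).comp
      (tendsto_natCast_atTop_atTop (R := ℝ))
    obtain ⟨N, h1, h2⟩ := ((Filter.eventually_ge_atTop 1).and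
      (h.eventually_ge_atTop (3 * M))).exists
    exact ⟨N, h1, h2⟩
  have hN : (1 : ℝ) ≤ N := by exact_mod_cast hN1
  have hNpos : (0 : ℝ) < N := by linarith
  have hR : 1 ≤ (N : ℝ) ^ α := Real.one_le_rpow hN hα0.le
  have hR2 : ((N : ℝ) ^ α) ^ 2 = (N : ℝ) ^ (2 * α) := by
    rw [mul_comm, Real.rpow_mul hNpos.le, Real.rpow_two]
  refine ⟨((N : ℝ) ^ α) ^ 2, one_le_pow₀ hR, ?_⟩
  have hf : Measurable fun p : ℝ × ℤ => p.1 ^ 2 + |(p.2 : ℝ)| ^ (2 * α) := by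
    have : Measurable fun n : ℤ => |(n : ℝ)| ^ (2 * α) := measurable_from_top
    exact (measurable_fst.pow_const 2).add (this.comp measurable_snd)
  rw [Measure.prod_apply_symm (by exact hf measurableSet_Icc), lintegral_count]
  calc ENNReal.ofReal M
      ≤ ENNReal.ofReal (N * (1 / (3 * (N : ℝ) ^ α))) := by
        apply ENNReal.ofReal_le_ofReal
        rw [Real.rpow_sub hNpos, Real.rpow_one, le_div_iff₀ (by linarith)] at hNM
        rw [mul_one_div, le_div_iff₀ (by linarith)]
        linarith
    _ = ∑ _n ∈ Finset.Icc (1 : ℤ) N, ENNReal.ofReal (1 / (3 * (N : ℝ) ^ α)) := by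
        rw [ENNReal.ofReal_mul hNpos.le]
        simp
    _ ≤ _ := by
        refine (Finset.sum_le_sum fun n hn => ?_).trans (ENNReal.sum_le_tsum (Finset.Icc (1 : ℤ) N))
        obtain ⟨h1, h2⟩ := Finset.mem_Icc.1 hn
        have h1' : (1 : ℝ) ≤ n := by exact_mod_cast h1
        have h2' : (n : ℝ) ≤ N := by exact_mod_cast h2
        refine ofReal_le_volume_slice (a := |(n : ℝ)| ^ (2 * α)) (by positivity) ?_ hR
        rw [hR2, abs_of_nonneg (by linarith)]
        exact Real.rpow_le_rpow (by linarith) h2' (by linarith)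
end
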